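/- Let q and γ be real numbers with q < 0. Let a connected multigraph on Fin n with edges Fin m be given, let s and t be two distinct vertices, let r = max(n, m), and assume r ≥ 2 and γ ≥ (8·max(|q|, 1/|q|))^r. Then Z_{st}(q, γ) < 0, Z_{s|t}(q, γ) > 0, and Z(q, γ) < 0. -/

import Mathlib

open scoped Classical

/-- Number of connected components of the simple graph on `Fin n` determined by
the edge subset `A` of a multigraph given by `ends : Fin m → Sym2 (Fin n)`. -/
noncomputable def numComponents {n m : ℕ} (ends : Fin m → Sym2 (Fin n))
    (A : Finset (Fin m)) : ℕ :=
  Nat.card (SimpleGraph.fromEdgeSet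
    ((A.image ends : Finset (Sym2 (Fin n))) : Set (Sym2 (Fin n)))).ConnectedComponent

/-- The random-cluster Tutte partition function `Z(q, γ)` of a multigraph. -/
noncomputable def tutteZ {K : Type*} [Field K] {n m : ℕ}
    (ends : Fin m → Sym2 (Fin n)) (q γ : K) : K :=
  ∑ A : Finset (Fin m), q ^ numComponents ends A * γ ^ A.card

/-- The contribution `Z_{st}(q, γ)` from edge subsets where `s` and `t` lie in
the same connected component. -/
noncomputable def tutteZst {K : Type*} [Field K] {n m : ℕ}
    (ends : Fin m → Sym2 (Fin n)) (q γ : K) (s t : Fin n) : K :=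
  ∑ A : Finset (Fin m),
    if (SimpleGraph.fromEdgeSet
        ((A.image ends : Finset (Sym2 (Fin n))) : Set (Sym2 (Fin n)))).Reachable s t
    then q ^ numComponents ends A * γ ^ A.card else 0

/-- The contribution `Z_{s|t}(q, γ) = Z(q, γ) - Z_{st}(q, γ)` from edge subsets
where `s` and `t` lie in different connected components. -/
noncomputable def tutteZsplit {K : Type*} [Field K] {n m : ℕ}
    (ends : Fin m → Sym2 (Fin n)) (q γ : K) (s t : Fin n) : K :=
  tutteZ ends q γ - tutteZst ends q γ s t

theorem key_pos {n m : ℕ} (k : Finset (Fin m) → ℕ) (q γ M : ℝ) (hM : 1 ≤ M) (hqM : |q| ≤ M)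
    (hγ1 : 1 ≤ γ) (hγ : 2 ^ m * M ^ n < γ) (F : Finset (Finset (Fin m))) (A0 : Finset (Fin m))
    (hA0 : A0 ∈ F) (hmax : ∀ A ∈ F, A.card ≤ A0.card) (j : ℕ)
    (hj : ∀ A ∈ F, A.card = A0.card → k A = j) (hk : ∀ A ∈ F, j ≤ k A ∧ k A ≤ n) :
    ∃ S : ℝ, 0 < S ∧ ∑ A ∈ F, q ^ k A * γ ^ A.card = q ^ j * S := by
  refine ⟨∑ A ∈ F, q ^ (k A - j) * γ ^ A.card, ?_, ?_⟩
  · have hγ0 : 0 < γ := by linarith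
    set D := γ ^ A0.card with hD
    have hDp : 0 < D := by positivity
    have hB : ∀ A ∈ F, -(M ^ n * (D / γ)) ≤ q ^ (k A - j) * γ ^ A.card := by
      intro A hA
      rcases (hmax A hA).eq_or_lt with h | h
      · rw [hj A hA h]
        simp only [Nat.sub_self, pow_zero, one_mul]
        have : 0 ≤ M ^ n * (D / γ) := by positivity
        have : 0 < γ ^ A.card := by positivity
        linarith
      · have h1 : |q ^ (k A - j)| ≤ M ^ n := by
          rw [abs_pow]
          calc |q| ^ (k A - j) ≤ M ^ (k A - j) := pow_le_pow_left₀ (abs_nonneg _) hqM _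
            _ ≤ M ^ n := pow_le_pow_right₀ hM (by have := (hk A hA).2; omega)
        have h2 : γ ^ A.card ≤ D / γ := by
          rw [le_div_iff₀ hγ0, ← pow_succ]
          exact pow_le_pow_right₀ hγ1 h
        have h3 : |q ^ (k A - j) * γ ^ A.card| ≤ M ^ n * (D / γ) := by
          rw [abs_mul, abs_of_pos (by positivity : 0 < γ ^ A.card)]
          exact mul_le_mul h1 h2 (by positivity) (by positivity)
        exact (abs_le.mp h3).1
    rw [← Finset.add_sum_erase F _ hA0, hj A0 hA0 rfl]
    have hs := Finset.card_nsmul_le_sum (F.erase A0) (fun A => q ^ (k A - j) * γ ^ A.card)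
      (-(M ^ n * (D / γ))) (fun A hA => hB A (Finset.mem_of_mem_erase hA))
    have hc : ((F.erase A0).card : ℝ) ≤ 2 ^ m := by
      have : (F.erase A0).card ≤ 2 ^ m := by
        have := Finset.card_le_univ (F.erase A0)
        simpa using this
      exact_mod_cast this
    rw [nsmul_eq_mul] at hs
    have hb : 0 ≤ M ^ n * (D / γ) := by positivity
    have h5 := mul_le_mul_of_nonneg_right hc hb
    have h6 : 2 ^ m * (M ^ n * (D / γ)) < D := by
      have : 2 ^ m * (M ^ n * (D / γ)) = (2 ^ m * M ^ n) * D / γ := by ring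
      rw [this, div_lt_iff₀ hγ0, mul_comm D]
      exact mul_lt_mul_of_pos_right hγ hDp
    simp only [Nat.sub_self, pow_zero, one_mul]
    linarith
  · rw [Finset.mul_sum]
    refine Finset.sum_congr rfl fun A hA => ?_
    rw [← mul_assoc, ← pow_add, Nat.add_sub_cancel' (hk A hA).1]

theorem reach_closed {V : Type*} {G : SimpleGraph V} (X : Set V)
    (hX : ∀ a b, G.Adj a b → a ∈ X → b ∈ X) {a b : V} (h : G.Reachable a b) (ha : a ∈ X) :
    b ∈ X := by
  obtain ⟨p⟩ := h
  induction p with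
  | nil => exact ha
  | cons h' _ ih => exact ih (hX _ _ h' ha)

theorem max_cut {n m : ℕ} (ends : Fin m → Sym2 (Fin n))
    (hconn : (SimpleGraph.fromEdgeSet
        (((Finset.univ.image ends : Finset (Sym2 (Fin n)))) : Set (Sym2 (Fin n)))).Connected)
    (s t : Fin n) (A : Finset (Fin m))
    (hA : ¬ (SimpleGraph.fromEdgeSet
        ((A.image ends : Finset (Sym2 (Fin n))) : Set (Sym2 (Fin n)))).Reachable s t)
    (hmax : ∀ B : Finset (Fin m), ¬ (SimpleGraph.fromEdgeSet
        ((B.image ends : Finset (Sym2 (Fin n))) : Set (Sym2 (Fin n)))).Reachable s t →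
        B.card ≤ A.card) (v : Fin n) :
    (SimpleGraph.fromEdgeSet
        ((A.image ends : Finset (Sym2 (Fin n))) : Set (Sym2 (Fin n)))).Reachable s v ∨
    (SimpleGraph.fromEdgeSet
        ((A.image ends : Finset (Sym2 (Fin n))) : Set (Sym2 (Fin n)))).Reachable t v := by
  set G := SimpleGraph.fromEdgeSet
        ((A.image ends : Finset (Sym2 (Fin n))) : Set (Sym2 (Fin n))) with hG
  refine reach_closed {v | G.Reachable s v ∨ G.Reachable t v} ?_ (hconn.preconnected s v)
    (Or.inl (SimpleGraph.Reachable.refl s))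
  intro u w huw hu
  by_contra hw
  simp only [Set.mem_setOf_eq, not_or] at hu hw
  rw [SimpleGraph.fromEdgeSet_adj] at huw
  obtain ⟨he, hne⟩ := huw
  simp only [Finset.coe_image, Finset.coe_univ, Set.image_univ, Set.mem_range] at he
  obtain ⟨e, he⟩ := he
  have heA : e ∉ A := by
    intro heA
    have hadj : G.Adj u w := by
      rw [hG, SimpleGraph.fromEdgeSet_adj]
      exact ⟨by simpa using ⟨e, heA, he⟩, hne⟩
    rcases hu with hu | hu
    · exact hw.1 (hu.trans hadj.reachable)
    · exact hw.2 (hu.trans hadj.reachable)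
  -- a vertex x whose component avoids both u and w
  have hstay : ∀ x, ¬ G.Reachable x u → ¬ G.Reachable x w → ∀ y, (SimpleGraph.fromEdgeSet
        (((insert e A).image ends : Finset (Sym2 (Fin n))) : Set (Sym2 (Fin n)))).Reachable x y →
        G.Reachable x y := by
    intro x hxu hxw y hxy
    refine reach_closed {y | G.Reachable x y} ?_ hxy (SimpleGraph.Reachable.refl x)
    intro a b hab ha
    simp only [Set.mem_setOf_eq] at ha ⊢
    rw [SimpleGraph.fromEdgeSet_adj] at hab
    obtain ⟨hab, hne'⟩ := hab
    rw [Finset.mem_coe, Finset.mem_image] at hab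
    obtain ⟨f, hf, hfe⟩ := hab
    rcases Finset.mem_insert.mp hf with rfl | hf
    · rw [he, Sym2.eq_iff] at hfe
      rcases hfe with ⟨rfl, rfl⟩ | ⟨rfl, rfl⟩
      · exact absurd ha hxu
      · exact absurd ha hxw
    · refine ha.trans (SimpleGraph.Adj.reachable ?_)
      rw [hG, SimpleGraph.fromEdgeSet_adj]
      exact ⟨by simpa using ⟨f, hf, hfe⟩, hne'⟩
  have hcard := hmax (insert e A) (by
    intro hr
    rcases hu with hu | hu
    · exact hA (hstay t (fun h => hA (hu.trans h.symm)) hw.2 s hr.symm).symm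
    · exact hA (hstay s (fun h => hA (h.trans hu.symm)) hw.1 t hr))
  rw [Finset.card_insert_of_notMem heA] at hcard
  omega

theorem numComponents_le {n m : ℕ} (ends : Fin m → Sym2 (Fin n)) (A : Finset (Fin m)) :
    numComponents ends A ≤ n := by
  unfold numComponents
  have := Nat.card_le_card_of_surjective (SimpleGraph.connectedComponentMk (SimpleGraph.fromEdgeSet
    ((A.image ends : Finset (Sym2 (Fin n))) : Set (Sym2 (Fin n))))) Quot.mk_surjective
  simpa using this

/-- Sign conclusions from Lemma 6.12: for `q < 0` and a connected multigraph
with `γ ≥ (8 max(|q|,1/|q|))^r`, `r = max(n,m) ≥ 2`, one has `Z_{st} < 0`,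
`Z_{s|t} > 0` and `Z < 0`. -/
theorem stmt_14 (q γ : ℝ) (hq : q < 0)
    (n m : ℕ) (ends : Fin m → Sym2 (Fin n))
    (hconn : (SimpleGraph.fromEdgeSet
        (((Finset.univ.image ends : Finset (Sym2 (Fin n)))) : Set (Sym2 (Fin n)))).Connected)
    (s t : Fin n) (hst : s ≠ t)
    (r : ℕ) (hr : r = max n m) (hr2 : 2 ≤ r)
    (hγ : (8 * max |q| (1 / |q|)) ^ r ≤ γ) :
    tutteZst ends q γ s t < 0 ∧
    0 < tutteZsplit ends q γ s t ∧
    tutteZ ends q γ < 0 := by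
  have hqa : 0 < |q| := abs_pos.mpr hq.ne
  set M := max |q| (1 / |q|) with hMdef
  have hqM : |q| ≤ M := le_max_left _ _
  have hM : 1 ≤ M := by
    rcases le_total 1 |q| with h | h
    · exact h.trans hqM
    · exact ((one_le_div hqa).mpr h).trans (le_max_right _ _)
  have hγ' : 2 ^ m * M ^ n < γ := by
    refine lt_of_lt_of_le ?_ hγ
    rw [mul_pow]
    have h1 : (2:ℝ) ^ m ≤ 2 ^ r := pow_le_pow_right₀ (by norm_num) (by omega)
    have h2 : (2:ℝ) ^ r < 8 ^ r := pow_lt_pow_left₀ (by norm_num) (by norm_num) (by omega)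
    have h3 : M ^ n ≤ M ^ r := pow_le_pow_right₀ hM (by omega)
    exact mul_lt_mul (h1.trans_lt h2) h3 (by positivity) (by positivity)
  have hγ1 : 1 ≤ γ := by
    have h1 : (1:ℝ) ≤ 2 ^ m := one_le_pow₀ (by norm_num)
    have h2 : 1 ≤ M ^ n := one_le_pow₀ hM
    nlinarith
  have hge1 : ∀ A, 1 ≤ numComponents ends A := by
    intro A
    unfold numComponents
    have : Nonempty (SimpleGraph.fromEdgeSet
      ((A.image ends : Finset (Sym2 (Fin n))) : Set (Sym2 (Fin n)))).ConnectedComponent :=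
      ⟨SimpleGraph.connectedComponentMk _ s⟩
    exact Nat.card_pos
  have huniv : numComponents ends Finset.univ = 1 := by
    unfold numComponents
    rw [Nat.card_eq_one_iff_unique]
    exact ⟨hconn.preconnected.subsingleton_connectedComponent,
      ⟨SimpleGraph.connectedComponentMk _ s⟩⟩
  have hU : ∀ A : Finset (Fin m), A.card = (Finset.univ : Finset (Fin m)).card →
      numComponents ends A = 1 := by
    intro A h
    rw [Finset.card_univ, Finset.card_eq_iff_eq_univ] at h
    rw [h, huniv]
  have hle := numComponents_le ends
  set R : Finset (Fin m) → Prop := fun A => (SimpleGraph.fromEdgeSet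
      ((A.image ends : Finset (Sym2 (Fin n))) : Set (Sym2 (Fin n)))).Reachable s t with hR
  have hZst : tutteZst ends q γ s t = ∑ A ∈ Finset.univ.filter R,
      q ^ numComponents ends A * γ ^ A.card := by
    unfold tutteZst
    rw [Finset.sum_filter]
  have hZsp : tutteZsplit ends q γ s t = ∑ A ∈ Finset.univ.filter (fun A => ¬ R A),
      q ^ numComponents ends A * γ ^ A.card := by
    unfold tutteZsplit
    rw [hZst, tutteZ, ← Finset.sum_filter_add_sum_filter_not Finset.univ R]
    ring
  refine ⟨?_, ?_, ?_⟩
  · obtain ⟨S, hS, hE⟩ := key_pos (numComponents ends) q γ M hM hqM hγ1 hγ'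
      (Finset.univ.filter R) Finset.univ
      (Finset.mem_filter.mpr ⟨Finset.mem_univ _, hconn.preconnected s t⟩)
      (fun A _ => Finset.card_le_univ A) 1 (fun A _ => hU A) (fun A _ => ⟨hge1 A, hle A⟩)
    rw [hZst, hE, pow_one]
    exact mul_neg_of_neg_of_pos hq hS
  · have hne : (Finset.univ.filter (fun A => ¬ R A)).Nonempty := by
      refine ⟨∅, Finset.mem_filter.mpr ⟨Finset.mem_univ _, ?_⟩⟩
      intro h
      refine hst (reach_closed {x | s = x} ?_ h rfl)
      intro a b hab
      simp at hab
    obtain ⟨A0, hA0, hmax⟩ := Finset.exists_max_image _ Finset.card hne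
    obtain ⟨S, hS, hE⟩ := key_pos (numComponents ends) q γ M hM hqM hγ1 hγ'
      (Finset.univ.filter (fun A => ¬ R A)) A0 hA0 hmax 2 (by
        intro A hA hc
        have hA' := (Finset.mem_filter.mp hA).2
        have hcut := max_cut ends hconn s t A hA' (fun B hB => by
          rw [hc]; exact hmax B (Finset.mem_filter.mpr ⟨Finset.mem_univ _, hB⟩))
        unfold numComponents
        rw [Nat.card_eq_two_iff]
        refine ⟨SimpleGraph.connectedComponentMk _ s, SimpleGraph.connectedComponentMk _ t,
          fun h => hA' (SimpleGraph.ConnectedComponent.exact h), ?_⟩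
        refine Set.eq_univ_of_forall fun c => ?_
        induction c using SimpleGraph.ConnectedComponent.ind with
        | _ v =>
          rcases hcut v with h | h
          · exact Or.inl (SimpleGraph.ConnectedComponent.sound h.symm)
          · exact Or.inr (SimpleGraph.ConnectedComponent.sound h.symm)) (by
        intro A hA
        refine ⟨?_, hle A⟩
        have hA' := (Finset.mem_filter.mp hA).2
        unfold numComponents
        have : Nontrivial (SimpleGraph.fromEdgeSet
          ((A.image ends : Finset (Sym2 (Fin n))) : Set (Sym2 (Fin n)))).ConnectedComponent :=
          ⟨SimpleGraph.connectedComponentMk _ s, SimpleGraph.connectedComponentMk _ t,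
            fun h => hA' (SimpleGraph.ConnectedComponent.exact h)⟩
        exact Finite.one_lt_card)
    rw [hZsp, hE]
    have hq2 : 0 < q ^ 2 := by nlinarith
    exact mul_pos hq2 hS
  · obtain ⟨S, hS, hE⟩ := key_pos (numComponents ends) q γ M hM hqM hγ1 hγ'
      Finset.univ Finset.univ (Finset.mem_univ _)
      (fun A _ => Finset.card_le_univ A) 1 (fun A _ => hU A) (fun A _ => ⟨hge1 A, hle A⟩)
    rw [tutteZ, hE, pow_one]
    exact mul_neg_of_neg_of_pos hq hS
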